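/- For all integers k > d ≥ 1 with (k,d) ≠ (2,1), there is no k to d cubical cut and project set which is LR_Ω with respect to the collection 𝒞_d of convex polytopes in ℝ^d with nonempty interior and vertices in ℤ^d. -/

import Mathlib

noncomputable section

open MeasureTheory Set Filter

/-- The distance from a real number to the nearest integer. -/
def distInt (x : ℝ) : ℝ := |x - round x|

/-- The real vector in `ℝ^k` corresponding to an integer vector. -/
def intVec {k : ℕ} (n : Fin k → ℤ) : Fin k → ℝ := fun i => (n i : ℝ)

/-- The embedding of `ℝ^d` into `ℝ^k` as the span of the first `d` coordinates. -/
def emb (k d : ℕ) (x : Fin d → ℝ) : Fin k → ℝ :=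
  fun i => if h : (i : ℕ) < d then x ⟨i, h⟩ else 0

/-- A `k` to `d` cut and project scheme: a totally irrational `d`-dimensional subspace
`E ⊆ ℝ^k`, the projection `proj = π` onto `E` along a complementary subspace `F_π`
(injective on `ℤ^k`), the projection `rho = ρ` onto `E` with respect to the decomposition
`ℝ^k = E + F_ρ` where `F_ρ = {0} × ℝ^{k-d}`, a window `W ⊆ F_ρ`, and a point `s`
(a representative of a point of `ℝ^k/ℤ^k`). -/
structure CPS (k d : ℕ) where
  E : Submodule ℝ (Fin k → ℝ)
  rank_E : Module.finrank ℝ E = d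
  /-- `E` is totally irrational: its image in `ℝ^k/ℤ^k` is dense,
  equivalently `E + ℤ^k` is dense in `ℝ^k`. -/
  totallyIrrational : Dense {x : Fin k → ℝ | ∃ e ∈ E, ∃ n : Fin k → ℤ, x = e + intVec n}
  /-- `π`, the projection onto `E` along a complementary subspace `F_π = ker proj`. -/
  proj : (Fin k → ℝ) →ₗ[ℝ] (Fin k → ℝ)
  proj_mem : ∀ x, proj x ∈ E
  proj_id : ∀ x ∈ E, proj x = x
  /-- `π` is injective on `ℤ^k`. -/
  proj_inj : ∀ m n : Fin k → ℤ, proj (intVec m) = proj (intVec n) → m = n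
  /-- `ρ`, the projection onto `E` with respect to the decomposition `ℝ^k = E + F_ρ`. -/
  rho : (Fin k → ℝ) →ₗ[ℝ] (Fin k → ℝ)
  rho_mem : ∀ x, rho x ∈ E
  /-- `x - ρ(x) ∈ F_ρ = {0} × ℝ^{k-d}`; in particular `ρ* = id - ρ` maps into `F_ρ`. -/
  rho_decomp : ∀ (x : Fin k → ℝ) (i : Fin k), (i : ℕ) < d → x i - rho x i = 0
  /-- The window `W ⊆ F_ρ`. -/
  window : Set (Fin k → ℝ)
  window_sub : ∀ x ∈ window, ∀ i : Fin k, (i : ℕ) < d → x i = 0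
  /-- A representative of the point `s ∈ ℝ^k/ℤ^k`. -/
  s : Fin k → ℝ

namespace CPS

variable {k d : ℕ} (𝒟 : CPS k d)

/-- `ρ* : ℝ^k → F_ρ`, the projection onto `F_ρ` along `E`. -/
def rhoStar (x : Fin k → ℝ) : Fin k → ℝ := x - 𝒟.rho x

/-- The strip `S = W + E`. -/
def strip : Set (Fin k → ℝ) := {z | ∃ w ∈ 𝒟.window, ∃ e ∈ (𝒟.E : Set (Fin k → ℝ)), z = w + e}

/-- The cut and project set `Y = π(S ∩ (ℤ^k + s))`. -/
def Y : Set (Fin k → ℝ) :=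
  𝒟.proj '' (𝒟.strip ∩ {z | ∃ n : Fin k → ℤ, z = intVec n + 𝒟.s})

/-- `s` is regular: `ℤ^k + s` does not meet the boundary of the strip. -/
def Regular : Prop := ∀ n : Fin k → ℤ, intVec n + 𝒟.s ∉ frontier 𝒟.strip

/-- `Y` is aperiodic: its group of periods is trivial. -/
def Aperiodic : Prop := ∀ x ∈ (𝒟.E : Set (Fin k → ℝ)),
  {z | ∃ y ∈ 𝒟.Y, z = y + x} = 𝒟.Y → x = 0

/-- The window is the cubical window `{Σ_{i=d+1}^k t_i e_i : 0 ≤ t_i < 1}`. -/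
def IsCubical : Prop :=
  𝒟.window = {x : Fin k → ℝ | ∀ i : Fin k,
    if (i : ℕ) < d then x i = 0 else 0 ≤ x i ∧ x i < 1}

/-- The window is the canonical window `ρ*([0,1]^k)`. -/
def IsCanonical : Prop :=
  𝒟.window = 𝒟.rhoStar '' {x : Fin k → ℝ | ∀ i, x i ∈ Icc (0 : ℝ) 1}

/-- `Y` is a cubical cut and project set: totally irrational (a field of `CPS`),
regular, aperiodic, and formed with the cubical window. -/
def IsCubicalCPSet : Prop := 𝒟.IsCubical ∧ 𝒟.Regular ∧ 𝒟.Aperiodic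

/-- `Y` is a canonical cut and project set. -/
def IsCanonicalCPSet : Prop := 𝒟.IsCanonical ∧ 𝒟.Regular ∧ 𝒟.Aperiodic

/-- For `y ∈ Y`, the (unique, by injectivity of `π` on `ℤ^k`) integer vector `ỹ`
with `ỹ + s ∈ S` and `π(ỹ + s) = y`. -/
def intRep (y : Fin k → ℝ) : Fin k → ℤ :=
  Classical.epsilon fun n : Fin k → ℤ =>
    intVec n + 𝒟.s ∈ 𝒟.strip ∧ 𝒟.proj (intVec n + 𝒟.s) = y

/-- The patch of shape `Ω` at `y`: `P(y,Ω) = {y' ∈ Y : ρ(ỹ' - ỹ) ∈ ρ(Ω)}`,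
where `Ω ⊆ ℝ^d` is viewed inside `⟨e₁,…,e_d⟩_ℝ ⊆ ℝ^k`. -/
def patch (Ω : Set (Fin d → ℝ)) (y : Fin k → ℝ) : Set (Fin k → ℝ) :=
  {y' | y' ∈ 𝒟.Y ∧
    𝒟.rho (intVec (𝒟.intRep y') - intVec (𝒟.intRep y)) ∈ 𝒟.rho '' (emb k d '' Ω)}

/-- Two patches of shape `Ω` are equivalent if they agree up to the translation
taking one distinguished point to the other. -/
def PatchEquiv (Ω : Set (Fin d → ℝ)) (y₁ y₂ : Fin k → ℝ) : Prop :=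
  𝒟.patch Ω y₁ = {z | ∃ w ∈ 𝒟.patch Ω y₂, z = w + (y₁ - y₂)}

/-- The pattern (equivalence class) of the patch of shape `Ω` at `y` occurs in the
region `R ⊆ E`: some point `y' ∈ Y ∩ R` has patch equivalent to that at `y`. -/
def OccursIn (Ω : Set (Fin d → ℝ)) (y : Fin k → ℝ) (R : Set (Fin k → ℝ)) : Prop :=
  ∃ y' ∈ 𝒟.Y ∩ R, 𝒟.PatchEquiv Ω y' y

/-- `Y` is linearly repetitive with respect to a collection `𝒜` of shapes in `ℝ^d`:
there is `C > 0` such that for every `Ω ∈ 𝒜`, every pattern of shape `Ω` occurring in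
`Y` occurs in every ball in `E` of volume `C·|Ω|` (balls in `E` being images under the
identification `ρ ∘ emb : ℝ^d ≅ E` of balls in `ℝ^d`). -/
def IsLR (𝒜 : Set (Set (Fin d → ℝ))) : Prop :=
  ∃ C > (0 : ℝ), ∀ Ω ∈ 𝒜, ∀ y ∈ 𝒟.Y, ∀ (x : Fin d → ℝ) (r : ℝ),
    volume (Metric.closedBall x r) = ENNReal.ofReal C * volume Ω →
    𝒟.OccursIn Ω y (𝒟.rho '' (emb k d '' Metric.closedBall x r))

/-- `Y` is `LR_Ω` with respect to a collection `𝒜` of shapes in `ℝ^d`: there is `C > 0`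
such that for every `Ω ∈ 𝒜`, every pattern of shape `Ω` occurring in `Y` occurs in every
translate of `C·Ω`. -/
def IsLROmega (𝒜 : Set (Set (Fin d → ℝ))) : Prop :=
  ∃ C > (0 : ℝ), ∀ Ω ∈ 𝒜, ∀ y ∈ 𝒟.Y, ∀ x : Fin d → ℝ,
    𝒟.OccursIn Ω y (𝒟.rho '' (emb k d '' {z | ∃ w ∈ Ω, z = x + C • w}))

end CPS

/-- `ℛ_d`: aligned rectangles in `ℝ^d` with integer vertices and nonempty interior. -/
def RdCollection (d : ℕ) : Set (Set (Fin d → ℝ)) :=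
  {Ω | ∃ a b : Fin d → ℤ, (∀ i, a i < b i) ∧
    Ω = {x : Fin d → ℝ | ∀ i, (a i : ℝ) ≤ x i ∧ x i ≤ (b i : ℝ)}}

/-- `𝒞_d`: convex polytopes in `ℝ^d` with vertices in `ℤ^d` and nonempty interior. -/
def CdCollection (d : ℕ) : Set (Set (Fin d → ℝ)) :=
  {Ω | (∃ V : Finset (Fin d → ℤ),
      Ω = convexHull ℝ ((fun n : Fin d → ℤ => intVec n) '' (V : Set (Fin d → ℤ)))) ∧
    (interior Ω).Nonempty}

namespace CPS

variable {k d : ℕ} (𝒟 : CPS k d)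

/-- the star coordinate of a lattice point -/
def X (n : Fin k → ℤ) : Fin k → ℝ := intVec n + 𝒟.s - 𝒟.rho (intVec n + 𝒟.s)

/-- lattice points lying in the strip -/
def Good (n : Fin k → ℤ) : Prop := ∀ i : Fin k, d ≤ (i : ℕ) → 0 ≤ 𝒟.X n i ∧ 𝒟.X n i < 1

lemma intVec_add' (m n : Fin k → ℤ) : intVec (m + n) = intVec m + intVec n := by
  funext i; simp [intVec]

lemma intVec_sub' (m n : Fin k → ℤ) : intVec (m - n) = intVec m - intVec n := by
  funext i; simp [intVec]

lemma rho_coord (x : Fin k → ℝ) (i : Fin k) (hi : (i : ℕ) < d) : 𝒟.rho x i = x i := by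
  have := 𝒟.rho_decomp x i hi
  linarith

lemma eq_zero_of_mem (hkd : d < k) (e : Fin k → ℝ) (he : e ∈ 𝒟.E)
    (h0 : ∀ i : Fin k, (i : ℕ) < d → e i = 0) : e = 0 := by
  let f : 𝒟.E →ₗ[ℝ] (Fin d → ℝ) :=
    (LinearMap.funLeft ℝ ℝ (fun j : Fin d => (⟨j, j.2.trans hkd⟩ : Fin k))).comp 𝒟.E.subtype
  have hf : Function.Surjective f := by
    intro x
    refine ⟨⟨𝒟.rho (emb k d x), 𝒟.rho_mem _⟩, ?_⟩
    funext j
    simp only [f, LinearMap.comp_apply, LinearMap.funLeft_apply, Submodule.subtype_apply]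
    rw [𝒟.rho_coord _ _ j.2]
    simp [emb]
  have hfi : Function.Injective f :=
    (LinearMap.injective_iff_surjective_of_finrank_eq_finrank
      (by rw [𝒟.rank_E]; simp)).2 hf
  have : (⟨e, he⟩ : 𝒟.E) = 0 := by
    apply hfi
    rw [map_zero]
    funext j
    simp only [f, LinearMap.comp_apply, LinearMap.funLeft_apply, Submodule.subtype_apply]
    exact h0 _ j.2
  simpa using congrArg Subtype.val this

lemma rho_eq_zero (hkd : d < k) (x : Fin k → ℝ)
    (h0 : ∀ i : Fin k, (i : ℕ) < d → x i = 0) : 𝒟.rho x = 0 :=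
  𝒟.eq_zero_of_mem hkd _ (𝒟.rho_mem x) fun i hi => by rw [𝒟.rho_coord _ _ hi, h0 i hi]

lemma rho_of_mem (hkd : d < k) (e : Fin k → ℝ) (he : e ∈ 𝒟.E) : 𝒟.rho e = e := by
  have := 𝒟.eq_zero_of_mem hkd (𝒟.rho e - e) (𝒟.E.sub_mem (𝒟.rho_mem e) he)
    (fun i hi => by simp [𝒟.rho_coord _ _ hi])
  exact sub_eq_zero.1 this

lemma rho_congr (hkd : d < k) (x y : Fin k → ℝ)
    (h0 : ∀ i : Fin k, (i : ℕ) < d → x i = y i) : 𝒟.rho x = 𝒟.rho y := by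
  have := 𝒟.rho_eq_zero hkd (x - y) (fun i hi => by simp [h0 i hi])
  rw [map_sub] at this
  exact sub_eq_zero.1 this

lemma mem_strip_iff (hkd : d < k) (hc : 𝒟.IsCubical) (n : Fin k → ℤ) :
    intVec n + 𝒟.s ∈ 𝒟.strip ↔ 𝒟.Good n := by
  unfold IsCubical at hc
  constructor
  · rintro ⟨w, hw, e, he, h⟩
    rw [hc] at hw
    have hr : 𝒟.rho w = 0 := 𝒟.rho_eq_zero hkd w fun i hi => by simpa [hi] using hw i
    have hX : 𝒟.X n = w := by
      unfold X
      rw [h, map_add, hr, 𝒟.rho_of_mem hkd e he]; simp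
    intro i hi
    rw [hX]
    simpa [not_lt.2 hi] using hw i
  · intro h
    refine ⟨𝒟.X n, ?_, 𝒟.rho (intVec n + 𝒟.s), 𝒟.rho_mem _, by simp [X]⟩
    rw [hc]
    intro i
    split_ifs with hi
    · simp only [X, Pi.sub_apply]
      rw [𝒟.rho_coord _ _ hi]; simp
    · exact h i (not_lt.1 hi)

lemma X_sub (m n : Fin k → ℤ) (i : Fin k) :
    𝒟.X m i - 𝒟.X n i = ((m i - n i : ℤ) : ℝ) - 𝒟.rho (intVec (m - n)) i := by
  simp only [X, intVec_sub', map_sub, map_add, Pi.sub_apply, Pi.add_apply]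
  simp only [intVec]
  push_cast
  ring

lemma good_unique (hkd : d < k) (m n : Fin k → ℤ) (hm : 𝒟.Good m) (hn : 𝒟.Good n)
    (h : ∀ i : Fin k, (i : ℕ) < d → m i = n i) : m = n := by
  funext i
  by_cases hi : (i : ℕ) < d
  · exact h i hi
  · have h1 := 𝒟.X_sub m n i
    rw [𝒟.rho_eq_zero hkd (intVec (m - n)) (fun j hj => by simp [intVec, h j hj])] at h1
    have h2 := hm i (not_lt.1 hi)
    have h3 := hn i (not_lt.1 hi)
    simp only [Pi.zero_apply, sub_zero] at h1
    have h4 : ((m i - n i : ℤ) : ℝ) < 1 := by linarith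
    have h5 : (-1 : ℝ) < ((m i - n i : ℤ) : ℝ) := by linarith
    have h6 : m i - n i < 1 := by exact_mod_cast h4
    have h7 : -1 < m i - n i := by exact_mod_cast h5
    omega

/-- moving by an integer vector `v` of `ℤ^d` from a given lattice point to a good one -/
lemma exists_good (hkd : d < k) (m : Fin k → ℤ) (v : Fin d → ℤ) :
    ∃ m' : Fin k → ℤ, 𝒟.Good m' ∧ (∀ j : Fin d, m' ⟨j, j.2.trans hkd⟩ =
      m ⟨j, j.2.trans hkd⟩ + v j) ∧
      ∀ i : Fin k, d ≤ (i : ℕ) →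
        m' i - m i = - ⌊𝒟.X m i - 𝒟.rho (emb k d (intVec v)) i⌋ := by
  let m' : Fin k → ℤ := fun i => if h : (i : ℕ) < d then m i + v ⟨i, h⟩ else
    m i - ⌊𝒟.X m i - 𝒟.rho (emb k d (intVec v)) i⌋
  have hr : 𝒟.rho (intVec (m' - m)) = 𝒟.rho (emb k d (intVec v)) := by
    apply 𝒟.rho_congr hkd
    intro i hi
    simp [m', intVec, emb, hi]
  refine ⟨m', ?_, ?_, ?_⟩
  · intro i hi
    have h1 := 𝒟.X_sub m' m i
    rw [hr] at h1
    have h2 : m' i - m i = - ⌊𝒟.X m i - 𝒟.rho (emb k d (intVec v)) i⌋ := by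
      simp [m', not_lt.2 hi]
    rw [h2] at h1
    push_cast at h1
    have h3 := Int.floor_le (𝒟.X m i - 𝒟.rho (emb k d (intVec v)) i)
    have h4 := Int.lt_floor_add_one (𝒟.X m i - 𝒟.rho (emb k d (intVec v)) i)
    constructor <;> linarith
  · intro j; simp [m']
  · intro i hi; simp [m', not_lt.2 hi]

lemma intRep_spec (hkd : d < k) (hc : 𝒟.IsCubical) (y : Fin k → ℝ) (hy : y ∈ 𝒟.Y) :
    𝒟.Good (𝒟.intRep y) ∧ 𝒟.proj (intVec (𝒟.intRep y) + 𝒟.s) = y := by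
  have : ∃ n : Fin k → ℤ, intVec n + 𝒟.s ∈ 𝒟.strip ∧ 𝒟.proj (intVec n + 𝒟.s) = y := by
    obtain ⟨z, ⟨hz, n, rfl⟩, h⟩ := hy
    exact ⟨n, hz, h⟩
  have h2 := Classical.epsilon_spec this
  rw [← 𝒟.mem_strip_iff hkd hc]
  exact h2

lemma mk_Y (hkd : d < k) (hc : 𝒟.IsCubical) (n : Fin k → ℤ) (hn : 𝒟.Good n) :
    𝒟.proj (intVec n + 𝒟.s) ∈ 𝒟.Y ∧ 𝒟.intRep (𝒟.proj (intVec n + 𝒟.s)) = n := by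
  have h1 : 𝒟.proj (intVec n + 𝒟.s) ∈ 𝒟.Y :=
    ⟨_, ⟨(𝒟.mem_strip_iff hkd hc n).2 hn, n, rfl⟩, rfl⟩
  refine ⟨h1, ?_⟩
  have h2 := (𝒟.intRep_spec hkd hc _ h1).2
  generalize 𝒟.intRep (𝒟.proj (intVec n + 𝒟.s)) = l at h2
  rw [map_add, map_add] at h2
  exact 𝒟.proj_inj _ _ (add_right_cancel h2)

lemma patch_floor (hkd : d < k) (hc : 𝒟.IsCubical) (Ω : Set (Fin d → ℝ)) (y₁ y₂ : Fin k → ℝ)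
    (hy₁ : y₁ ∈ 𝒟.Y) (hy₂ : y₂ ∈ 𝒟.Y) (h : 𝒟.PatchEquiv Ω y₁ y₂) (v : Fin d → ℤ)
    (hv : intVec v ∈ Ω) (i : Fin k) (hi : d ≤ (i : ℕ)) :
    ⌊𝒟.X (𝒟.intRep y₁) i - 𝒟.rho (emb k d (intVec v)) i⌋ =
      ⌊𝒟.X (𝒟.intRep y₂) i - 𝒟.rho (emb k d (intVec v)) i⌋ := by
  obtain ⟨hn, hny⟩ := 𝒟.intRep_spec hkd hc y₁ hy₁
  obtain ⟨hm, hmy⟩ := 𝒟.intRep_spec hkd hc y₂ hy₂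
  set n := 𝒟.intRep y₁ with hndef
  set m := 𝒟.intRep y₂ with hmdef
  obtain ⟨m', hm', hm'1, hm'2⟩ := 𝒟.exists_good hkd m v
  obtain ⟨n', hn', hn'1, hn'2⟩ := 𝒟.exists_good hkd n v
  obtain ⟨hY, hrep⟩ := 𝒟.mk_Y hkd hc m' hm'
  have hp : 𝒟.proj (intVec m' + 𝒟.s) ∈ 𝒟.patch Ω y₂ := by
    refine ⟨hY, emb k d (intVec v), ⟨_, hv, rfl⟩, ?_⟩
    rw [hrep, ← hmdef, ← intVec_sub']
    apply 𝒟.rho_congr hkd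
    intro i hi
    have := hm'1 ⟨i, hi⟩
    simp only [Fin.eta] at this
    simp [intVec, emb, hi, this]
  have hp1 : 𝒟.proj (intVec m' + 𝒟.s) + (y₁ - y₂) ∈ 𝒟.patch Ω y₁ := by
    rw [h]; exact ⟨_, hp, rfl⟩
  obtain ⟨hq, hq2⟩ := 𝒟.intRep_spec hkd hc _ hp1.1
  set l := 𝒟.intRep (𝒟.proj (intVec m' + 𝒟.s) + (y₁ - y₂))
  have hl : l = m' + (n - m) := by
    apply 𝒟.proj_inj
    rw [← hny, ← hmy] at hq2
    simp only [intVec_add', intVec_sub', map_add, map_sub] at hq2 ⊢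
    have := congrArg (fun z => z - 𝒟.proj 𝒟.s) hq2
    rw [add_sub_cancel_right] at this
    rw [this]; abel
  have hln : l = n' := by
    apply 𝒟.good_unique hkd _ _ hq hn'
    intro j hj
    have h1 := hm'1 ⟨j, hj⟩
    have h2 := hn'1 ⟨j, hj⟩
    simp only [Fin.eta] at h1 h2
    rw [hl]
    simp [h1, h2]
    ring
  have h3 := hm'2 i hi
  have h4 := hn'2 i hi
  rw [← hln, hl] at h4
  simp only [Pi.add_apply, Pi.sub_apply] at h4
  omega

lemma region_bound (hkd : d < k) (hc : 𝒟.IsCubical) :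
    ∃ B : ℕ, ∀ y ∈ 𝒟.Y, ∀ w : Fin d → ℝ, 𝒟.rho (emb k d w) = y → ∀ j : Fin d,
      |((𝒟.intRep y ⟨j, j.2.trans hkd⟩ : ℤ) : ℝ) - w j| ≤ B := by
  obtain ⟨B₁, hB₁⟩ : ∃ B : ℝ, ∀ x : Fin k → ℝ, ‖𝒟.proj x‖ ≤ B * ‖x‖ :=
    ⟨_, fun x => (LinearMap.toContinuousLinearMap 𝒟.proj).le_opNorm x⟩
  obtain ⟨B, hB⟩ := exists_nat_ge (|B₁| + ‖𝒟.s‖)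
  refine ⟨B, fun y hy w hw j => ?_⟩
  obtain ⟨hg, hy2⟩ := 𝒟.intRep_spec hkd hc y hy
  set n := 𝒟.intRep y
  set J : Fin k := ⟨j, j.2.trans hkd⟩ with hJ
  have hJd : (J : ℕ) < d := j.2
  have h1 : y J = w j := by
    rw [← hw, 𝒟.rho_coord _ _ hJd]; simp [emb, J]
  have h2 : y = 𝒟.rho (intVec n + 𝒟.s) + 𝒟.proj (𝒟.X n) := by
    rw [← hy2]
    conv_rhs => rw [← 𝒟.proj_id _ (𝒟.rho_mem (intVec n + 𝒟.s)), ← map_add]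
    simp [X]
  have h3 : w j = n J + 𝒟.s J + 𝒟.proj (𝒟.X n) J := by
    rw [← h1, h2, Pi.add_apply, 𝒟.rho_coord _ _ hJd]; simp [intVec]
  have h4 : ‖𝒟.X n‖ ≤ 1 := by
    rw [pi_norm_le_iff_of_nonneg zero_le_one]
    intro i
    by_cases hi : (i : ℕ) < d
    · simp only [X, Pi.sub_apply]
      rw [𝒟.rho_coord _ _ hi]; simp
    · have := hg i (not_lt.1 hi)
      rw [Real.norm_eq_abs, abs_le]; constructor <;> linarith
  have h5 : |𝒟.proj (𝒟.X n) J| ≤ |B₁| := by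
    calc |𝒟.proj (𝒟.X n) J| ≤ ‖𝒟.proj (𝒟.X n)‖ := norm_le_pi_norm (𝒟.proj (𝒟.X n)) J
      _ ≤ B₁ * ‖𝒟.X n‖ := hB₁ _
      _ ≤ |B₁| * ‖𝒟.X n‖ := by gcongr; exact le_abs_self _
      _ ≤ |B₁| * 1 := by gcongr
      _ = _ := mul_one _
  have h6 : |𝒟.s J| ≤ ‖𝒟.s‖ := norm_le_pi_norm 𝒟.s J
  rw [h3]
  have : (n J : ℝ) - (n J + 𝒟.s J + 𝒟.proj (𝒟.X n) J) = -(𝒟.s J + 𝒟.proj (𝒟.X n) J) := by ring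
  rw [this, abs_neg]
  have := abs_add_le (𝒟.s J) (𝒟.proj (𝒟.X n) J)
  linarith

lemma dense_X (hkd : d < k) (lo hi : Fin k → ℝ) (h : ∀ i, lo i < hi i) :
    ∃ n : Fin k → ℤ, ∀ i : Fin k, d ≤ (i : ℕ) → lo i < 𝒟.X n i ∧ 𝒟.X n i < hi i := by
  have hcont : Continuous 𝒟.rho := LinearMap.continuous_of_finiteDimensional _
  let U : Set (Fin k → ℝ) := ⋂ i : Fin k, {z | d ≤ (i : ℕ) →
    lo i < (z + 𝒟.s - 𝒟.rho (z + 𝒟.s)) i ∧ (z + 𝒟.s - 𝒟.rho (z + 𝒟.s)) i < hi i}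
  have hU : IsOpen U := by
    apply isOpen_iInter_of_finite
    intro i
    by_cases hd : d ≤ (i : ℕ)
    · simp only [hd, true_imp_iff]
      have hc : Continuous fun z : Fin k → ℝ => (z + 𝒟.s - 𝒟.rho (z + 𝒟.s)) i := by fun_prop
      exact (isOpen_lt continuous_const hc).inter (isOpen_lt hc continuous_const)
    · simp [hd]
  have hne : U.Nonempty := by
    let t : Fin k → ℝ := fun i => if (i : ℕ) < d then 0 else (lo i + hi i) / 2
    refine ⟨t - 𝒟.s, ?_⟩
    simp only [U, Set.mem_iInter, Set.mem_ofPred_eq, sub_add_cancel]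
    rw [𝒟.rho_eq_zero hkd t (fun i hi => by simp [t, hi])]
    intro i hi'
    have := h i
    simp only [sub_zero, t, not_lt.2 hi', if_false]
    constructor <;> linarith
  obtain ⟨z, hz, e, he, n, rfl⟩ := 𝒟.totallyIrrational.inter_open_nonempty U hU hne
  refine ⟨n, fun i hi' => ?_⟩
  have h1 := Set.mem_iInter.1 hz i hi'
  have h2 : e + intVec n + 𝒟.s - 𝒟.rho (e + intVec n + 𝒟.s) = 𝒟.X n := by
    unfold X
    rw [add_assoc, map_add, 𝒟.rho_of_mem hkd e he]; abel
  rwa [h2] at h1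

/-- the slope coefficients -/
def al (i : Fin k) (j : Fin d) : ℝ := 𝒟.rho (emb k d (Pi.single j 1)) i

lemma emb_sum (x : Fin d → ℝ) :
    emb k d x = ∑ j, x j • emb k d (Pi.single j 1) := by
  funext i
  simp only [emb, Finset.sum_apply, Pi.smul_apply, smul_eq_mul]
  split_ifs with h
  · simp [Pi.single_apply]
  · simp

lemma rho_emb (x : Fin d → ℝ) (i : Fin k) :
    𝒟.rho (emb k d x) i = ∑ j, x j * 𝒟.al i j := by
  rw [emb_sum, map_sum]
  simp [al]

lemma exists_irrational (hkd : d < k) (i : Fin k) (hi : d ≤ (i : ℕ)) :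
    ∃ j, Irrational (𝒟.al i j) := by
  by_contra! hcon
  have h1 : ∀ j, ∃ q : ℚ, (q : ℝ) = 𝒟.al i j := by
    intro j
    have := hcon j
    simpa [Irrational] using this
  choose q hq using h1
  let Q : ℕ := ∏ j, (q j).den
  have hQ : 0 < Q := Finset.prod_pos fun j _ => (q j).den_pos
  have hQint : ∀ j, ∃ z : ℤ, (Q : ℝ) * 𝒟.al i j = z := by
    intro j
    obtain ⟨c, hc⟩ : (q j).den ∣ Q := Finset.dvd_prod_of_mem _ (Finset.mem_univ j)
    refine ⟨c * (q j).num, ?_⟩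
    rw [← hq j, hc]
    have := Rat.den_mul_eq_num (q j)
    have h2 : ((q j).den : ℝ) * (q j : ℝ) = (q j).num := by exact_mod_cast this
    push_cast
    rw [← h2]; ring
  choose z hz using hQint
  have hQr : (0 : ℝ) < Q := by exact_mod_cast hQ
  have hkey : ∀ n : Fin k → ℤ, ∃ N : ℤ, (Q : ℝ) * (𝒟.X n i - 𝒟.X 0 i) = N := by
    intro n
    refine ⟨Q * n i - ∑ j : Fin d, n ⟨j, j.2.trans hkd⟩ * z j, ?_⟩
    rw [𝒟.X_sub]
    have : 𝒟.rho (intVec (n - 0)) =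
        𝒟.rho (emb k d (intVec fun j : Fin d => n ⟨j, j.2.trans hkd⟩)) := by
      apply 𝒟.rho_congr hkd
      intro i hi
      simp [intVec, emb, hi]
    rw [this, 𝒟.rho_emb, mul_sub, Finset.mul_sum]
    push_cast
    simp only [intVec, ← hz]
    congr 1
    · simp
    · apply Finset.sum_congr rfl
      intro j _
      ring
  obtain ⟨n, hn⟩ := 𝒟.dense_X hkd (fun _ => 𝒟.X 0 i) (fun _ => 𝒟.X 0 i + 1 / Q)
    (fun _ => by have : (0:ℝ) < 1 / Q := by positivity
                 linarith)
  obtain ⟨N, hN⟩ := hkey n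
  obtain ⟨h2, h3⟩ := hn i hi
  have h4 : (0 : ℝ) < N := by rw [← hN]; apply mul_pos hQr; linarith
  have h5 : (N : ℝ) < 1 := by
    rw [← hN]
    calc (Q : ℝ) * (𝒟.X n i - 𝒟.X 0 i) < Q * (1 / Q) := by
          apply mul_lt_mul_of_pos_left _ hQr; linarith
      _ = 1 := by field_simp
  have h6 : 0 < N := by exact_mod_cast h4
  have h7 : N < 1 := by exact_mod_cast h5
  omega

end CPS

namespace CPS

variable {k d : ℕ} (𝒟 : CPS k d)

lemma exists_gap (N : ℕ) (θ : Fin (N + 1) → ℝ) (h1 : ∀ j, θ j < 1) (j : Fin (N + 1)) :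
    ∃ u : ℝ, θ j < u ∧ u ≤ 1 ∧ ∀ j', θ j' ≤ θ j ∨ u ≤ θ j' := by
  have h2 : ∀ᶠ u in nhdsWithin (θ j) (Set.Ioi (θ j)), ∀ j', θ j' ≤ θ j ∨ u ≤ θ j' := by
    rw [Filter.eventually_all]
    intro j'
    by_cases h : θ j' ≤ θ j
    · simp [h]
    · have : ∀ᶠ u in nhdsWithin (θ j) (Set.Ioi (θ j)), u < θ j' :=
        nhdsWithin_le_nhds (Iio_mem_nhds (not_le.1 h))
      filter_upwards [this] with u hu
      exact Or.inr hu.le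
  have h3 : ∀ᶠ u in nhdsWithin (θ j) (Set.Ioi (θ j)), u < 1 :=
    nhdsWithin_le_nhds (Iio_mem_nhds (h1 j))
  have h4 : ∀ᶠ u in nhdsWithin (θ j) (Set.Ioi (θ j)), θ j < u := self_mem_nhdsWithin
  obtain ⟨u, hu2, hu3, hu4⟩ := (h2.and (h3.and h4)).exists
  exact ⟨u, hu4, hu3.le, hu2⟩

lemma fract_inj (α : ℝ) (hα : Irrational α) (m n : ℕ)
    (h : Int.fract (m * α) = Int.fract (n * α)) : m = n := by
  by_contra hne
  rw [Int.fract_eq_fract] at h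
  obtain ⟨z, hz⟩ := h
  have h1 : ((m : ℤ) - n : ℤ) ≠ 0 := by omega
  have h2 := hα.intCast_mul h1
  apply h2.ne_int z
  push_cast
  rw [← hz]; ring

lemma floor_sep (x y t : ℝ) (h : ⌊x - t⌋ = ⌊y - t⌋) (hx : x < Int.fract t)
    (hy : Int.fract t < y) : False := by
  have h1 : ⌊x - t⌋ < -⌊t⌋ := by
    rw [Int.floor_lt]
    have := Int.floor_add_fract t
    push_cast; linarith
  have h2 : -⌊t⌋ ≤ ⌊y - t⌋ := by
    rw [Int.le_floor]
    have := Int.floor_add_fract t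
    push_cast; linarith
  omega

lemma mem_one (N : ℕ) (hN : 0 < N) :
    convexHull ℝ ((fun n : Fin 1 → ℤ => intVec n) ''
      (({0, fun _ => (N : ℤ)} : Finset (Fin 1 → ℤ)) : Set (Fin 1 → ℤ))) =
      {x : Fin 1 → ℝ | 0 ≤ x 0 ∧ x 0 ≤ N} := by
  have hNr : (0 : ℝ) < N := by exact_mod_cast hN
  apply Set.Subset.antisymm
  · apply convexHull_min
    · rintro _ ⟨n, hn, rfl⟩
      simp only [Finset.coe_insert, Finset.coe_singleton, Set.mem_insert_iff,
        Set.mem_singleton_iff] at hn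
      rcases hn with rfl | rfl <;> simp [intVec]
    · intro x hx y hy a b ha hb hab
      simp only [Set.mem_ofPred_eq, Pi.add_apply, Pi.smul_apply, smul_eq_mul] at *
      constructor
      · nlinarith [mul_nonneg ha hx.1, mul_nonneg hb hy.1]
      · nlinarith [mul_le_mul_of_nonneg_left hx.2 ha, mul_le_mul_of_nonneg_left hy.2 hb]
  · intro x hx
    simp only [Finset.coe_insert, Finset.coe_singleton, Set.image_insert_eq,
      Set.image_singleton]
    rw [convexHull_pair]
    refine ⟨1 - x 0 / N, x 0 / N, ?_, ?_, by ring, ?_⟩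
    · have : x 0 / N ≤ 1 := by rw [div_le_one hNr]; exact hx.2
      linarith
    · exact div_nonneg hx.1 hNr.le
    · funext j
      have : j = 0 := Subsingleton.elim _ _
      subst this
      simp [intVec]
      field_simp

theorem case_one (𝒟 : CPS k 1) (hk : 3 ≤ k) (hc : 𝒟.IsCubical) :
    ¬ 𝒟.IsLROmega (CdCollection 1) := by
  rintro ⟨C, hC, hLR⟩
  have hkd : 1 < k := by omega
  obtain ⟨B, hB⟩ := 𝒟.region_bound hkd hc
  obtain ⟨c, hcC⟩ := exists_nat_ge C
  let N : ℕ := c + 2 * B + 1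
  have hN : 0 < N := by omega
  let V : Finset (Fin 1 → ℤ) := {0, fun _ => (N : ℤ)}
  let Ω : Set (Fin 1 → ℝ) := convexHull ℝ ((fun n : Fin 1 → ℤ => intVec n) '' (V : Set (Fin 1 → ℤ)))
  have hΩ : Ω = {x : Fin 1 → ℝ | 0 ≤ x 0 ∧ x 0 ≤ N} := mem_one N hN
  have hΩC : Ω ∈ CdCollection 1 := by
    refine ⟨⟨V, rfl⟩, ?_⟩
    rw [hΩ]
    have hopen : IsOpen {x : Fin 1 → ℝ | 0 < x 0 ∧ x 0 < N} :=
      (isOpen_lt continuous_const (continuous_apply 0)).inter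
        (isOpen_lt (continuous_apply 0) continuous_const)
    refine ⟨fun _ => 1 / 2, ?_⟩
    apply interior_maximal _ hopen
    · have : (1 : ℝ) ≤ N := by exact_mod_cast hN
      constructor
      · norm_num
      · change (1 / 2 : ℝ) < N
        linarith
    · intro x hx; exact ⟨hx.1.le, hx.2.le⟩
  have hmemΩ : ∀ j : Fin (N + 1), intVec (fun _ : Fin 1 => ((j : ℕ) : ℤ)) ∈ Ω := by
    intro j
    rw [hΩ]
    have : (j : ℕ) ≤ N := by omega
    have h2 : ((j : ℕ) : ℝ) ≤ N := by exact_mod_cast this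
    simp [intVec, h2]
  have hirr : ∀ i : Fin k, 1 ≤ (i : ℕ) → Irrational (𝒟.al i 0) := by
    intro i hi
    obtain ⟨j, hj⟩ := 𝒟.exists_irrational hkd i hi
    rwa [Subsingleton.elim j 0] at hj
  have hrho : ∀ (j : ℕ) (i : Fin k), 𝒟.rho (emb k 1 (intVec (fun _ : Fin 1 => (j : ℤ)))) i
      = j * 𝒟.al i 0 := by
    intro j i
    rw [𝒟.rho_emb]; simp [intVec]
  let θ : Fin k → Fin (N + 1) → ℝ := fun i j => Int.fract ((j : ℕ) * 𝒟.al i 0)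
  have hgap : ∀ i j, ∃ u : ℝ, θ i j < u ∧ u ≤ 1 ∧ ∀ j', θ i j' ≤ θ i j ∨ u ≤ θ i j' :=
    fun i j => exists_gap N (θ i) (fun j => Int.fract_lt_one _) j
  choose u hu1 hu2 hu3 using hgap
  let i1 : Fin k := ⟨1, by omega⟩
  let i2 : Fin k := ⟨2, by omega⟩
  -- a point for each pair
  have hpt : ∀ p : Fin (N + 1) × Fin (N + 1), ∃ n : Fin k → ℤ, 𝒟.Good n ∧
      (θ i1 p.1 < 𝒟.X n i1 ∧ 𝒟.X n i1 < u i1 p.1) ∧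
      (θ i2 p.2 < 𝒟.X n i2 ∧ 𝒟.X n i2 < u i2 p.2) := by
    intro p
    let J : Fin k → Fin (N + 1) := fun i => if i = i1 then p.1 else p.2
    obtain ⟨n, hn⟩ := 𝒟.dense_X hkd (fun i => θ i (J i)) (fun i => u i (J i))
      (fun i => hu1 _ _)
    refine ⟨n, ?_, ?_, ?_⟩
    · intro i hi
      have h1 := hn i hi
      have h2 : 0 ≤ θ i (J i) := Int.fract_nonneg _
      have h3 := hu2 i (J i)
      constructor <;> linarith
    · simpa [J] using hn i1 (by simp [i1])
    · have : i2 ≠ i1 := by simp [i1, i2]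
      simpa [J, this] using hn i2 (by simp [i2])
  choose m hmG hm1 hm2 using hpt
  have hocc : ∀ p, ∃ y ∈ 𝒟.Y, (∃ w : Fin 1 → ℝ, 0 ≤ w 0 ∧ w 0 ≤ c * N ∧
      𝒟.rho (emb k 1 w) = y) ∧ 𝒟.PatchEquiv Ω y (𝒟.proj (intVec (m p) + 𝒟.s)) := by
    intro p
    obtain ⟨y, ⟨hy, _, ⟨_, ⟨w, hw, rfl⟩, rfl⟩, rfl⟩, hE⟩ :=
      hLR Ω hΩC _ (𝒟.mk_Y hkd hc (m p) (hmG p)).1 0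
    refine ⟨_, hy, ⟨_, ?_, ?_, rfl⟩, hE⟩
    · rw [hΩ] at hw
      have := mul_nonneg hC.le hw.1
      simpa using this
    · rw [hΩ] at hw
      have := mul_le_mul hcC hw.2 hw.1 (Nat.cast_nonneg _)
      simpa using this
  choose y hyY hyw hyE using hocc
  have hfl : ∀ p (j : ℕ), j < N + 1 → ∀ i : Fin k, 1 ≤ (i : ℕ) →
      ⌊𝒟.X (𝒟.intRep (y p)) i - j * 𝒟.al i 0⌋ = ⌊𝒟.X (m p) i - j * 𝒟.al i 0⌋ := by
    intro p j hj i hi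
    have h1 := 𝒟.mk_Y hkd hc (m p) (hmG p)
    have := 𝒟.patch_floor hkd hc Ω _ _ (hyY p) h1.1 (hyE p) _ (hmemΩ ⟨j, hj⟩) i hi
    rwa [h1.2, hrho] at this
  have hsep : ∀ (i : Fin k), 1 ≤ (i : ℕ) → ∀ (j j' : Fin (N + 1)) (x x' : ℝ),
      (θ i j < x ∧ x < u i j) → (θ i j' < x' ∧ x' < u i j') →
      (∀ l : ℕ, l < N + 1 → ⌊x - l * 𝒟.al i 0⌋ = ⌊x' - l * 𝒟.al i 0⌋) → j = j' := by
    intro i hi j j' x x' hx hx' hl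
    by_contra hne
    have hθ : θ i j ≠ θ i j' := by
      intro h
      exact hne (Fin.ext (fract_inj _ (hirr i hi) _ _ h))
    rcases lt_or_gt_of_ne hθ with h | h
    · rcases hu3 i j j' with h3 | h3
      · linarith
      · exact floor_sep _ _ _ (hl j' j'.2) (lt_of_lt_of_le hx.2 h3) hx'.1
    · rcases hu3 i j' j with h3 | h3
      · linarith
      · exact floor_sep _ _ _ (hl j j.2).symm (lt_of_lt_of_le hx'.2 h3) hx.1
  let z0 : Fin k := ⟨0, by omega⟩
  have hinj : Function.Injective fun p => 𝒟.intRep (y p) z0 := by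
    intro p p' hpp
    have heq : 𝒟.intRep (y p) = 𝒟.intRep (y p') := by
      apply 𝒟.good_unique hkd _ _ (𝒟.intRep_spec hkd hc _ (hyY p)).1
        (𝒟.intRep_spec hkd hc _ (hyY p')).1
      intro i hi
      have : i = z0 := Fin.ext (by simp [z0]; omega)
      rw [this]; exact hpp
    have hfl2 : ∀ i : Fin k, 1 ≤ (i : ℕ) → ∀ l : ℕ, l < N + 1 →
        ⌊𝒟.X (m p) i - l * 𝒟.al i 0⌋ = ⌊𝒟.X (m p') i - l * 𝒟.al i 0⌋ := by
      intro i hi l hl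
      rw [← hfl p l hl i hi, ← hfl p' l hl i hi, heq]
    apply Prod.ext
    · exact hsep i1 (by simp [i1]) _ _ _ _ (hm1 p) (hm1 p') (hfl2 i1 (by simp [i1]))
    · exact hsep i2 (by simp [i2]) _ _ _ _ (hm2 p) (hm2 p') (hfl2 i2 (by simp [i2]))
  have hrange : ∀ p, 𝒟.intRep (y p) z0 ∈ Finset.Icc (-(B : ℤ)) (c * N + B) := by
    intro p
    obtain ⟨w, hw0, hw1, hw⟩ := hyw p
    have h1 := abs_le.1 (hB _ (hyY p) w hw 0)
    have h2 : (⟨((0 : Fin 1) : ℕ), (0 : Fin 1).2.trans hkd⟩ : Fin k) = z0 := by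
      simp [z0]
    rw [h2] at h1
    rw [Finset.mem_Icc]
    constructor
    · have : (-(B : ℝ)) ≤ (𝒟.intRep (y p) z0 : ℝ) := by linarith [h1.1]
      exact_mod_cast this
    · have : (𝒟.intRep (y p) z0 : ℝ) ≤ c * N + B := by linarith [h1.2]
      exact_mod_cast this
  have hcard := Finset.card_le_card_of_injOn (s := Finset.univ) _ (fun p _ => hrange p)
    hinj.injOn
  simp only [Finset.card_univ, Fintype.card_prod, Fintype.card_fin, Int.card_Icc] at hcard
  have h1 : (c * N + B + 1 - -(B : ℤ)).toNat = c * N + 2 * B + 1 := by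
    have : (c * N + B + 1 - -(B : ℤ)) = ((c * N + 2 * B + 1 : ℕ) : ℤ) := by push_cast; ring
    rw [this]; exact Int.toNat_natCast _
  rw [h1] at hcard
  have h2 : c * N + (2 * B + 1) * 1 ≤ N * N := by
    calc c * N + (2 * B + 1) * 1 ≤ c * N + (2 * B + 1) * N := by gcongr; omega
      _ = N * N := by simp only [N]; ring
  nlinarith

end CPS

namespace CPS

variable {k d : ℕ} (𝒟 : CPS k d)

lemma exists_delta (α : ℝ) (hα : Irrational α) (K : ℕ) :
    ∃ δ : ℝ, 0 < δ ∧ δ ≤ 1 ∧ ∀ j : ℤ, j ≠ 0 → |j| ≤ K → ∀ m : ℤ, δ ≤ |j * α - m| := by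
  have h1 : ∀ᶠ δ in nhdsWithin (0 : ℝ) (Set.Ioi 0), ∀ j ∈ Finset.Icc (-(K : ℤ)) K,
      j ≠ 0 → δ ≤ |j * α - round (j * α)| := by
    rw [Filter.eventually_all_finset]
    intro j _
    by_cases hj : j = 0
    · simp [hj]
    · have hpos : 0 < |j * α - round (j * α)| := by
        rw [abs_pos, sub_ne_zero]
        exact (hα.intCast_mul hj).ne_int _
      have : ∀ᶠ δ in nhdsWithin (0 : ℝ) (Set.Ioi 0), δ < |j * α - round (j * α)| :=
        nhdsWithin_le_nhds (Iio_mem_nhds hpos)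
      filter_upwards [this] with u hu _
      exact hu.le
  have h3 : ∀ᶠ u in nhdsWithin (0 : ℝ) (Set.Ioi 0), u < 1 :=
    nhdsWithin_le_nhds (Iio_mem_nhds one_pos)
  have h4 : ∀ᶠ u in nhdsWithin (0 : ℝ) (Set.Ioi 0), 0 < u := self_mem_nhdsWithin
  obtain ⟨δ, hu2, hu3, hu4⟩ := (h1.and (h3.and h4)).exists
  refine ⟨δ, hu4, hu3.le, fun j hj hK m => ?_⟩
  rw [abs_le] at hK
  exact (hu2 j (Finset.mem_Icc.2 hK) hj).trans (round_le _ m)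

lemma exists_q (α γ : ℝ) (hα : Irrational α) (δ : ℝ) (hδ : 0 < δ) :
    ∃ q p : ℤ, 0 < q * α + γ + p ∧ q * α + γ + p < δ := by
  have hd : Dense (AddSubgroup.closure {α, 1} : Set ℝ) :=
    dense_addSubgroupClosure_pair_iff.2 (by simpa using hα)
  obtain ⟨x, hx, hxm⟩ := hd.inter_open_nonempty (Set.Ioo (-γ) (δ - γ)) isOpen_Ioo
    ⟨δ / 2 - γ, by constructor <;> linarith⟩
  obtain ⟨q, p, rfl⟩ := AddSubgroup.mem_closure_pair.1 hxm
  refine ⟨q, p, ?_, ?_⟩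
  · have := hx.1
    simp only [zsmul_eq_mul, mul_one] at this
    linarith
  · have := hx.2
    simp only [zsmul_eq_mul, mul_one] at this
    linarith

/-- inverse shear -/
def shr (q : ℤ) (a b : Fin d) (x : Fin d → ℝ) : Fin d → ℝ :=
  fun j => x j - if j = a then q * x b else 0

/-- images of the standard basis under the shear -/
def shb (q : ℤ) (a b : Fin d) (j : Fin d) : Fin d → ℤ :=
  fun l => (if l = j then 1 else 0) + if l = a then (if j = b then q else 0) else 0

/-- vertices of the sheared simplex -/
def shV (q : ℤ) (a b : Fin d) : Finset (Fin d → ℤ) := insert 0 (Finset.univ.image (shb q a b))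

/-- sheared simplex -/
def shΩ (q : ℤ) (a b : Fin d) : Set (Fin d → ℝ) :=
  convexHull ℝ ((fun n : Fin d → ℤ => intVec n) '' (shV q a b : Set (Fin d → ℤ)))

lemma shr_add (q : ℤ) (a b : Fin d) (x y : Fin d → ℝ) (c : ℝ) (j : Fin d) :
    shr q a b (x + c • y) j = shr q a b x j + c * shr q a b y j := by
  simp only [shr, Pi.add_apply, Pi.smul_apply, smul_eq_mul]
  split_ifs <;> ring

lemma shr_mem (q : ℤ) (a b : Fin d) (hab : b ≠ a) (x : Fin d → ℝ) (hx : x ∈ shΩ q a b)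
    (j : Fin d) : 0 ≤ shr q a b x j ∧ shr q a b x j ≤ 1 := by
  have hsub : shΩ q a b ⊆ {x | ∀ j, 0 ≤ shr q a b x j ∧ shr q a b x j ≤ 1} := by
    apply convexHull_min
    · rintro _ ⟨n, hn, rfl⟩
      simp only [shV, Finset.coe_insert, Finset.coe_image, Finset.coe_univ, Set.image_univ,
        Set.mem_insert_iff, Set.mem_range] at hn
      rcases hn with rfl | ⟨l, rfl⟩
      · intro j; simp [shr, intVec]
      · intro j
        have : shr q a b (intVec (shb q a b l)) j = if j = l then 1 else 0 := by
          simp only [shr, intVec, shb, hab, if_false]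
          by_cases h1 : j = a <;> by_cases h2 : l = b <;> by_cases h3 : j = l <;>
            simp_all [eq_comm]
        rw [this]
        split_ifs <;> norm_num
    · intro x hx y hy s t hs ht hst j
      have h1 : shr q a b (s • x + t • y) j = s * shr q a b x j + t * shr q a b y j := by
        rw [shr_add]
        congr 1
        simp only [shr, Pi.smul_apply, smul_eq_mul]
        split_ifs <;> ring
      rw [h1]
      have hx := hx j
      have hy := hy j
      constructor
      · nlinarith [mul_nonneg hs hx.1, mul_nonneg ht hy.1]
      · nlinarith [mul_le_mul_of_nonneg_left hx.2 hs, mul_le_mul_of_nonneg_left hy.2 ht]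
  exact hsub hx j

lemma shr_sum (q : ℤ) (a b : Fin d) (hab : b ≠ a) (x : Fin d → ℝ) :
    x = ∑ j, shr q a b x j • intVec (shb q a b j) := by
  funext l
  simp only [Finset.sum_apply, Pi.smul_apply, smul_eq_mul, intVec, shb]
  push_cast
  simp only [mul_add, Finset.sum_add_distrib]
  by_cases h : l = a
  · subst h
    simp [shr, hab]
    ring
  · simp [shr, h]

lemma shΩ_mem (q : ℤ) (a b : Fin d) (hab : b ≠ a) : shΩ q a b ∈ CdCollection d := by
  refine ⟨⟨shV q a b, rfl⟩, ?_⟩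
  have hc : ∀ j, Continuous fun x : Fin d → ℝ => shr q a b x j := by
    intro j
    unfold shr
    split_ifs <;> fun_prop
  let U : Set (Fin d → ℝ) := (⋂ j, {x | 0 < shr q a b x j}) ∩ {x | ∑ j, shr q a b x j < 1}
  have hU : IsOpen U :=
    (isOpen_iInter_of_finite fun j => isOpen_lt continuous_const (hc j)).inter
      (isOpen_lt (continuous_finsetSum _ fun j _ => hc j) continuous_const)
  have hsub : U ⊆ shΩ q a b := by
    intro x hx
    have hx1 : ∀ j, 0 < shr q a b x j := fun j => Set.mem_iInter.1 hx.1 j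
    have hx2 : ∑ j, shr q a b x j < 1 := hx.2
    have := (convex_convexHull ℝ ((fun n : Fin d → ℤ => intVec n) ''
      (shV q a b : Set (Fin d → ℤ)))).sum_mem (t := (Finset.univ : Finset (Option (Fin d))))
      (w := fun o => o.elim (1 - ∑ j, shr q a b x j) (shr q a b x))
      (z := fun o => o.elim 0 (fun j => intVec (shb q a b j))) ?_ ?_ ?_
    · rw [Fintype.sum_option] at this
      simp only [Option.elim, smul_zero, zero_add] at this
      rw [← shr_sum q a b hab x] at this
      exact this
    · rintro (_ | j) _
      · simp only [Option.elim]; linarith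
      · exact (hx1 j).le
    · rw [Fintype.sum_option]; simp
    · rintro (_ | j) _
      · exact subset_convexHull ℝ _ ⟨0, by simp [shV], by funext; simp [intVec]⟩
      · exact subset_convexHull ℝ _ ⟨shb q a b j, by simp [shV], rfl⟩
  refine ⟨fun j => 1 / (d + 1 : ℝ) + if j = a then (q : ℝ) * (1 / (d + 1 : ℝ)) else 0,
    interior_maximal hsub hU ?_⟩
  have hs : ∀ j, shr q a b (fun j => 1 / (d + 1 : ℝ) + if j = a then q * (1 / (d + 1 : ℝ)) else 0) j
      = 1 / (d + 1) := by
    intro j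
    simp only [shr, hab, if_false]
    split_ifs <;> ring
  refine ⟨Set.mem_iInter.2 fun j => ?_, ?_⟩
  · have h0 : (0 : ℝ) < 1 / (d + 1) := by positivity
    rw [← hs j] at h0
    exact h0
  · refine lt_of_eq_of_lt (Finset.sum_congr rfl fun j _ => hs j) ?_
    simp only [Finset.sum_const, Finset.card_univ, Fintype.card_fin, nsmul_eq_mul]
    rw [mul_one_div, div_lt_one (by positivity)]
    linarith

theorem case_two (hkd : d < k) (hd : 2 ≤ d) (hc : 𝒟.IsCubical) :
    ¬ 𝒟.IsLROmega (CdCollection d) := by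
  rintro ⟨C, hC, hLR⟩
  obtain ⟨B, hB⟩ := 𝒟.region_bound hkd hc
  obtain ⟨c, hcC⟩ := exists_nat_ge C
  let i : Fin k := ⟨d, hkd⟩
  have hi : d ≤ (i : ℕ) := le_refl d
  obtain ⟨a, ha⟩ := 𝒟.exists_irrational hkd i hi
  obtain ⟨b, hab⟩ : ∃ b : Fin d, b ≠ a := by
    have : Nontrivial (Fin d) := Fin.nontrivial_iff_two_le.2 hd
    exact exists_ne a
  set α := 𝒟.al i a with hα
  let K : ℕ := (c + 2) ^ d
  obtain ⟨δ, hδ, hδ1, hδK⟩ := exists_delta α ha K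
  obtain ⟨q, p, hq0, hqδ⟩ := exists_q α (𝒟.al i b) ha δ hδ
  set β := q * α + 𝒟.al i b + p with hβ
  let Ω := shΩ q a b
  have hv : intVec (shb q a b b) ∈ Ω :=
    subset_convexHull ℝ _ ⟨shb q a b b, by simp [shV], rfl⟩
  have hrv : 𝒟.rho (emb k d (intVec (shb q a b b))) i = β - p := by
    rw [𝒟.rho_emb]
    simp only [intVec, shb, if_true]
    push_cast
    simp only [add_mul, Finset.sum_add_distrib]
    simp [hβ, hα]
    ring
  -- the rare pattern
  obtain ⟨m, hm⟩ := 𝒟.dense_X hkd (fun _ => 0) (fun _ => β) (fun _ => hq0)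
  have hmG : 𝒟.Good m := fun l hl => ⟨(hm l hl).1.le, by linarith [(hm l hl).2]⟩
  obtain ⟨hmY, hmR⟩ := 𝒟.mk_Y hkd hc m hmG
  have hrare : ∀ y ∈ 𝒟.Y, 𝒟.PatchEquiv Ω y (𝒟.proj (intVec m + 𝒟.s)) →
      𝒟.X (𝒟.intRep y) i < β := by
    intro y hy hE
    have h1 := 𝒟.patch_floor hkd hc Ω _ _ hy hmY hE _ hv i hi
    rw [hmR, hrv] at h1
    have h2 : ⌊𝒟.X m i - (β - p)⌋ < p := by
      rw [Int.floor_lt]; linarith [(hm i hi).2]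
    rw [← h1, Int.floor_lt] at h2
    linarith
  let B' : ℕ := B * (1 + q.natAbs)
  let t : ℕ := 2 * B' + 1
  let Z : ℕ := (K + 1) * t
  have ht : 0 < t := Nat.succ_pos _
  have hocc : ∀ z : Fin d → Fin Z, ∃ y ∈ 𝒟.Y, 𝒟.X (𝒟.intRep y) i < β ∧
      ∃ w : Fin d → ℝ, 𝒟.rho (emb k d w) = y ∧ ∀ j, ((c + 1) * ((z j : ℕ) : ℝ) ≤ shr q a b w j ∧
        shr q a b w j ≤ (c + 1) * ((z j : ℕ) : ℝ) + c) := by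
    intro z
    let x : Fin d → ℝ := fun j => (c + 1) * ((z j : ℕ) : ℝ) +
      if j = a then q * ((c + 1) * ((z b : ℕ) : ℝ)) else 0
    have hx : ∀ j, shr q a b x j = (c + 1) * ((z j : ℕ) : ℝ) := by
      intro j
      simp only [shr, x, hab, if_false]
      split_ifs <;> ring
    obtain ⟨y, ⟨hy, _, ⟨_, ⟨w, hw, rfl⟩, rfl⟩, rfl⟩, hE⟩ :=
      hLR Ω (shΩ_mem q a b hab) _ hmY x
    refine ⟨_, hy, hrare _ hy hE, _, rfl, fun j => ?_⟩
    rw [shr_add, hx]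
    have h1 := shr_mem q a b hab w hw j
    have h2 := mul_nonneg hC.le h1.1
    have h3 : C * shr q a b w j ≤ c * 1 := mul_le_mul hcC h1.2 h1.1 (Nat.cast_nonneg _)
    constructor <;> linarith
  choose y hyY hyX w hwy hw using hocc
  let J : Fin d → Fin k := fun j => ⟨j, j.2.trans hkd⟩
  let n : (Fin d → Fin Z) → Fin k → ℤ := fun z => 𝒟.intRep (y z)
  let bb : (Fin d → Fin Z) → Fin d → ℤ := fun z j =>
    n z (J j) - if j = a then q * n z (J b) else 0
  have hnB : ∀ z j, |(n z (J j) : ℝ) - w z j| ≤ B := fun z j => hB _ (hyY z) _ (hwy z) j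
  have hbB : ∀ z j, |(bb z j : ℝ) - shr q a b (w z) j| ≤ B' := by
    intro z j
    have e1 := hnB z j
    have hB'e : (B' : ℝ) = B + |(q : ℝ)| * B := by
      simp only [B']; push_cast
      rw [Nat.cast_natAbs]; push_cast; ring
    have hBn : (0 : ℝ) ≤ |(q : ℝ)| * B := by positivity
    simp only [bb, shr]
    by_cases hj : j = a
    · simp only [hj, if_true] at e1 ⊢
      push_cast
      have e2 : |(q : ℝ) * ((n z (J b) : ℝ) - w z b)| ≤ |(q : ℝ)| * B := by
        rw [abs_mul]; gcongr; exact hnB z b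
      have e3 : (n z (J a) : ℝ) - q * n z (J b) - (w z a - q * w z b) =
        ((n z (J a) : ℝ) - w z a) - q * ((n z (J b) : ℝ) - w z b) := by ring
      rw [e3, hB'e]
      exact (abs_sub _ _).trans (add_le_add e1 e2)
    · simp only [hj, if_false, sub_zero]
      rw [hB'e]; linarith
  have hb0 : ∀ z j, 0 ≤ bb z j + B' := by
    intro z j
    have h1 := (abs_le.1 (hbB z j)).1
    have h2 := (hw z j).1
    have h3 : (0 : ℝ) ≤ (c + 1) * ((z j : ℕ) : ℝ) := by positivity
    have h4 : (0 : ℝ) ≤ ((bb z j + B' : ℤ) : ℝ) := by push_cast; linarith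
    exact_mod_cast h4
  have hb1 : ∀ z j, bb z j + B' < (c + 2) * Z := by
    intro z j
    have h1 := (abs_le.1 (hbB z j)).2
    have h2 := (hw z j).2
    have h3 : (((z j : ℕ) : ℝ)) + 1 ≤ Z := by exact_mod_cast (z j).2
    have h4 : (c + 1) * (((z j : ℕ) : ℝ) + 1) ≤ (c + 1) * (Z : ℝ) := by gcongr
    have h5 : 2 * B' + 1 ≤ Z := by
      simp only [Z]
      exact Nat.le_mul_of_pos_left t (Nat.succ_pos K)
    have h6 : 2 * (B' : ℝ) + 1 ≤ Z := by exact_mod_cast h5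
    have h7 : ((bb z j + B' : ℤ) : ℝ) < ((c + 2) * Z : ℤ) := by push_cast; linarith
    exact_mod_cast h7
  let φ : (Fin d → Fin Z) → Fin d → ℤ := fun z j =>
    if j = a then (bb z j + B') / ((K : ℤ) + 1) else bb z j + B'
  have hKpos : (0 : ℤ) < (K : ℤ) + 1 := by positivity
  have hinj : Function.Injective φ := by
    intro z z' hzz
    have h1 : ∀ j, j ≠ a → bb z j = bb z' j := by
      intro j hj
      have := congrFun hzz j
      simpa [φ, hj] using this
    have h2 : (bb z a + B') / ((K : ℤ) + 1) = (bb z' a + B') / ((K : ℤ) + 1) := by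
      have := congrFun hzz a
      simpa only [φ, if_true] using this
    have h3 : ∀ j, j ≠ a → n z (J j) = n z' (J j) := by
      intro j hj
      have := h1 j hj
      simpa [bb, hj] using this
    have h4 : bb z a - bb z' a = n z (J a) - n z' (J a) := by
      simp only [bb, if_true, h3 b hab]; ring
    set D : ℤ := n z (J a) - n z' (J a) with hD
    have h5 : |D| ≤ K := by
      rw [← h4]
      have e1 := Int.mul_ediv_add_emod (bb z a + B') ((K : ℤ) + 1)
      have e2 := Int.mul_ediv_add_emod (bb z' a + B') ((K : ℤ) + 1)
      have e3 := Int.emod_nonneg (bb z a + B') hKpos.ne'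
      have e4 := Int.emod_nonneg (bb z' a + B') hKpos.ne'
      have e5 := Int.emod_lt_of_pos (bb z a + B') hKpos
      have e6 := Int.emod_lt_of_pos (bb z' a + B') hKpos
      rw [h2] at e1
      rw [abs_le]; constructor <;> linarith
    obtain ⟨hg, hgy⟩ := 𝒟.intRep_spec hkd hc _ (hyY z)
    obtain ⟨hg', hgy'⟩ := 𝒟.intRep_spec hkd hc _ (hyY z')
    have h6 : 𝒟.rho (intVec (n z - n z')) = 𝒟.rho (emb k d (D • Pi.single a (1 : ℝ))) := by
      apply 𝒟.rho_congr hkd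
      intro l hl
      have hJl : l = J ⟨l, hl⟩ := rfl
      by_cases hla : (⟨l, hl⟩ : Fin d) = a
      · have : l = J a := by rw [hJl, hla]
        simp only [emb, hl, dif_pos, hla, intVec, Pi.sub_apply, Pi.smul_apply, Pi.single_eq_same]
        rw [this]; simp [hD]
      · have := h3 _ hla
        rw [← hJl] at this
        simp [emb, hl, hla, intVec, this]
    have h7 : D = 0 := by
      by_contra hD0
      have h8 := 𝒟.X_sub (n z) (n z') i
      rw [h6, 𝒟.rho_emb] at h8
      have h9 : ∑ j, (D • Pi.single a (1 : ℝ) : Fin d → ℝ) j * 𝒟.al i j = D * α := by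
        simp [Pi.single_apply, hα]
      rw [h9] at h8
      have h10 := hδK D hD0 h5 (n z i - n z' i)
      rw [abs_sub_comm, ← h8] at h10
      have e1 := hg i hi
      have e2 := hg' i hi
      have e3 := hyX z
      have e4 := hyX z'
      have : |𝒟.X (n z) i - 𝒟.X (n z') i| < δ := by
        rw [abs_lt]; constructor <;> simp only [n] <;> linarith
      linarith
    have h8 : n z = n z' := by
      apply 𝒟.good_unique hkd _ _ hg hg'
      intro l hl
      by_cases hla : (⟨l, hl⟩ : Fin d) = a
      · have : l = J a := by rw [← hla]
        rw [this]
        change n z (J a) = n z' (J a)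
        omega
      · exact h3 _ hla
    have h9 : y z = y z' := by
      rw [← hgy, ← hgy']
      change 𝒟.proj (intVec (n z) + 𝒟.s) = 𝒟.proj (intVec (n z') + 𝒟.s)
      rw [h8]
    have h10 : w z = w z' := by
      funext j
      have e1 := 𝒟.rho_coord (emb k d (w z)) (J j) j.2
      have e2 := 𝒟.rho_coord (emb k d (w z')) (J j) j.2
      rw [hwy, h9, ← hwy z', e2] at e1
      simpa [emb, J] using e1.symm
    have key : ∀ x x' : ℕ, ∀ r : ℝ, (c + 1) * (x : ℝ) ≤ r → r ≤ (c + 1) * (x' : ℝ) + c →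
        x ≤ x' := by
      intro x x' r e1 e2
      by_contra hlt
      have e3 : x' + 1 ≤ x := by omega
      have e4 : (x' : ℝ) + 1 ≤ x := by exact_mod_cast e3
      have e5 : (c + 1) * ((x' : ℝ) + 1) ≤ (c + 1) * (x : ℝ) := by gcongr
      linarith
    funext j
    apply Fin.ext
    have e1 := hw z j
    have e2 := hw z' j
    rw [h10] at e1
    exact le_antisymm (key _ _ _ e1.1 e2.2) (key _ _ _ e2.1 e1.2)
  let box : Finset (Fin d → ℤ) := Fintype.piFinset fun j =>
    Finset.Ico (0 : ℤ) (if j = a then ((c + 2) * t : ℕ) else ((c + 2) * Z : ℕ))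
  have hbox : ∀ z, φ z ∈ box := by
    intro z
    rw [Fintype.mem_piFinset]
    intro j
    rw [Finset.mem_Ico]
    by_cases hj : j = a
    · simp only [φ, hj, if_true]
      refine ⟨Int.ediv_nonneg (hb0 z a) hKpos.le, ?_⟩
      apply Int.ediv_lt_of_lt_mul hKpos
      have := hb1 z a
      simp only [Z] at this
      push_cast at this ⊢
      linarith
    · simp only [φ, hj, if_false]
      refine ⟨hb0 z j, ?_⟩
      have := hb1 z j
      push_cast
      exact this
  have hcard := Finset.card_le_card_of_injOn (s := Finset.univ) φ (fun z _ => hbox z)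
    hinj.injOn
  have hboxc : (K + 1) * box.card = ((c + 2) * Z) ^ d := by
    have e1 : box.card = ∏ j : Fin d, (if j = a then (c + 2) * t else (c + 2) * Z) := by
      rw [Fintype.card_piFinset]
      apply Finset.prod_congr rfl
      intro j _
      rw [Int.card_Ico]
      split_ifs <;> (rw [sub_zero]; exact Int.toNat_natCast _)
    have e2 : K + 1 = ∏ j : Fin d, (if j = a then K + 1 else 1) := by simp
    rw [e1, e2, ← Finset.prod_mul_distrib]
    have e3 : ∀ j ∈ (Finset.univ : Finset (Fin d)), ((if j = a then K + 1 else 1) *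
        (if j = a then (c + 2) * t else (c + 2) * Z)) = (c + 2) * Z := by
      intro j _
      split_ifs
      · simp only [Z]; ring
      · ring
    rw [Finset.prod_congr rfl e3]
    simp
  simp only [Finset.card_univ, Fintype.card_fun, Fintype.card_fin] at hcard
  have hZ : 0 < Z ^ d := by positivity
  have h1 : (K + 1) * Z ^ d ≤ (c + 2) ^ d * Z ^ d := by
    rw [← mul_pow, ← hboxc]
    exact Nat.mul_le_mul_left _ hcard
  have h2 := Nat.le_of_mul_le_mul_right h1 hZ
  simp only [K] at h2
  omega

end CPS
/-- For all integers `k > d ≥ 1` with `(k,d) ≠ (2,1)`, there is no `k` to `d`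
cubical cut and project set which is `LR_Ω` with respect to `𝒞_d`. -/
theorem no_cubical_LROmega_wrt_Cd (k d : ℕ) (hd : 1 ≤ d) (hkd : d < k)
    (hne : ¬(k = 2 ∧ d = 1)) (𝒟 : CPS k d) (h : 𝒟.IsCubicalCPSet) :
    ¬ 𝒟.IsLROmega (CdCollection d) := by
  
  by_cases h2 : 2 ≤ d
  · exact 𝒟.case_two hkd h2 h.1
  · obtain rfl : d = 1 := by omega
    exact CPS.case_one 𝒟 (by omega) h.1
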